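/- Let 𝒳 be a nonempty finite set, Θ ⊆ ℝ^k open, and θ ↦ p_θ a continuously differentiable family of strictly positive probability distributions on 𝒳 such that at a given θ ∈ Θ the vectors ∂p_θ/∂θ_1, …, ∂p_θ/∂θ_k are linearly independent (so G^{(α)}(θ) is invertible). Then for every A : 𝒳 → ℝ, writing E(θ) := ∑_{x∈𝒳} A(x) p_θ(x), one has V_α[A] ≥ (1 / ∑_{y∈𝒳} p_θ(y)^{1−α}) · ∑_{i,j=1}^k (G^{(α)}(θ)^{−1})_{ij} · ∂E/∂θ_i(θ) · ∂E/∂θ_j(θ), with equality if and only if the function x ↦ A(x) − E_α[A] lies in the linear span of the functions x ↦ p_θ(x)^{α−1} ∂p_θ(x)/∂θ_i, i = 1, …, k. Here V_α[A] and E_α[A] are taken under the escort distribution of p_θ. -/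

import Mathlib

open Finset Matrix

/-- Pairing a function with a linear combination of `g` under a weighted sum. -/
theorem sum_weight_mul_linearCombination {X ι : Type*} [Fintype X] [Fintype ι]
    (w f : X → ℝ) (g : ι → X → ℝ) (c : ι → ℝ) :
    ∑ x, w x * f x * ∑ i, c i * g i x = ∑ i, c i * ∑ x, w x * f x * g i x := by
  simp only [mul_sum]
  rw [sum_comm]
  exact sum_congr rfl fun i _ => sum_congr rfl fun x _ => by ring

theorem weightedGram_mulVec {X ι : Type*} [Fintype X] [Fintype ι]
    (w : X → ℝ) (g : ι → X → ℝ) (G : Matrix ι ι ℝ)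
    (hG : ∀ i j, G i j = ∑ x, w x * g i x * g j x) (c : ι → ℝ) (i : ι) :
    (G *ᵥ c) i = ∑ x, w x * (∑ j, c j * g j x) * g i x := by
  calc (G *ᵥ c) i = ∑ j, c j * ∑ x, w x * g i x * g j x := by
        simp only [mulVec, dotProduct, hG]
        exact sum_congr rfl fun j _ => mul_comm _ _
    _ = ∑ x, w x * (∑ j, c j * g j x) * g i x := by
        rw [← sum_weight_mul_linearCombination]
        exact sum_congr rfl fun x _ => by ring

/-- A weighted sum of squares with positive weights vanishes only at zero. -/
theorem sum_weight_mul_sq_eq_zero_iff {X : Type*} [Fintype X] {w : X → ℝ}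
    (hw : ∀ x, 0 < w x) (r : X → ℝ) : ∑ x, w x * r x ^ 2 = 0 ↔ ∀ x, r x = 0 := by
  rw [sum_eq_zero_iff_of_nonneg fun x _ => mul_nonneg (hw x).le (sq_nonneg _)]
  simp [(hw _).ne']

theorem isUnit_weightedGram {X ι : Type*} [Fintype X] [Fintype ι] [DecidableEq ι]
    {w : X → ℝ} (hw : ∀ x, 0 < w x) {g : ι → X → ℝ} (hg : LinearIndependent ℝ g)
    (G : Matrix ι ι ℝ) (hG : ∀ i j, G i j = ∑ x, w x * g i x * g j x) : IsUnit G := by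
  rw [← mulVec_injective_iff_isUnit]
  refine (injective_iff_map_eq_zero G.mulVecLin).2 fun c hc => ?_
  have hc' : ∀ i, ∑ x, w x * (∑ j, c j * g j x) * g i x = 0 := fun i => by
    rw [← weightedGram_mulVec w g G hG]
    exact congrFun hc i
  have hsq : ∑ x, w x * (∑ j, c j * g j x) ^ 2 = 0 := by
    have h := sum_weight_mul_linearCombination w (fun x => ∑ j, c j * g j x) g c
    simp only [hc', mul_zero, sum_const_zero] at h
    rw [← h]
    exact sum_congr rfl fun x _ => by ring
  have h0 := (sum_weight_mul_sq_eq_zero_iff hw _).1 hsq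
  funext i
  refine Fintype.linearIndependent_iff.1 hg c ?_ i
  funext x
  simpa using h0 x

/-- Pythagoras for the residual of a weighted least squares problem, whose coefficients `c`
solve the normal equations. -/
theorem sum_weight_mul_residual_sq {X ι : Type*} [Fintype X] [Fintype ι]
    (w f : X → ℝ) (g : ι → X → ℝ) (G : Matrix ι ι ℝ)
    (hG : ∀ i j, G i j = ∑ x, w x * g i x * g j x) (c : ι → ℝ)
    (hc : ∀ i, (G *ᵥ c) i = ∑ x, w x * f x * g i x) :
    ∑ x, w x * (f x - ∑ i, c i * g i x) ^ 2
      = ∑ x, w x * f x ^ 2 - ∑ i, c i * ∑ x, w x * f x * g i x := by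
  have h₁ := sum_weight_mul_linearCombination w f g c
  have h₂ := sum_weight_mul_linearCombination w (fun x => ∑ j, c j * g j x) g c
  simp only [← weightedGram_mulVec w g G hG, hc] at h₂
  calc ∑ x, w x * (f x - ∑ i, c i * g i x) ^ 2
      = ∑ x, w x * f x ^ 2 - 2 * ∑ x, w x * f x * ∑ i, c i * g i x
        + ∑ x, w x * (∑ i, c i * g i x) * ∑ i, c i * g i x := by
        rw [mul_sum, ← sum_sub_distrib, ← sum_add_distrib]
        exact sum_congr rfl fun x _ => by ring
    _ = _ := by rw [h₁, h₂]; ring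

/-- Bessel's inequality for a weighted inner product on functions on a finite type, in terms of
the inverse Gram matrix, with its equality case. -/
theorem weighted_bessel {X ι : Type*} [Fintype X] [Fintype ι] [DecidableEq ι]
    {w : X → ℝ} (hw : ∀ x, 0 < w x) {g : ι → X → ℝ} (hg : LinearIndependent ℝ g)
    (G : Matrix ι ι ℝ) (hG : ∀ i j, G i j = ∑ x, w x * g i x * g j x)
    (f : X → ℝ) (b : ι → ℝ) (hb : ∀ i, b i = ∑ x, w x * f x * g i x) :
    ∑ i, ∑ j, G⁻¹ i j * b i * b j ≤ ∑ x, w x * f x ^ 2 ∧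
      (∑ x, w x * f x ^ 2 = ∑ i, ∑ j, G⁻¹ i j * b i * b j ↔
        f ∈ Submodule.span ℝ (Set.range g)) := by
  have hdet : IsUnit G.det := (isUnit_iff_isUnit_det G).1 (isUnit_weightedGram hw hg G hG)
  set c : ι → ℝ := G⁻¹ *ᵥ b with hc
  have hGc : G *ᵥ c = b := by rw [hc, mulVec_mulVec, mul_nonsing_inv G hdet, one_mulVec]
  have hres := sum_weight_mul_residual_sq w f g G hG c fun i => by rw [hGc, hb]
  have hquad : ∑ i, ∑ j, G⁻¹ i j * b i * b j = ∑ i, c i * ∑ x, w x * f x * g i x := by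
    refine sum_congr rfl fun i _ => ?_
    rw [← hb, hc, mulVec, dotProduct, sum_mul]
    exact sum_congr rfl fun j _ => by ring
  have hnonneg : 0 ≤ ∑ x, w x * (f x - ∑ i, c i * g i x) ^ 2 :=
    sum_nonneg fun x _ => mul_nonneg (hw x).le (sq_nonneg _)
  rw [hquad]
  refine ⟨by linarith, ?_⟩
  rw [← sub_eq_zero, ← hres, sum_weight_mul_sq_eq_zero_iff hw, Submodule.mem_span_range_iff_exists_fun]
  constructor
  · intro h
    refine ⟨c, funext fun x => ?_⟩
    simpa using (sub_eq_zero.1 (h x)).symm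
  · rintro ⟨a, ha⟩ x
    have hfa : ∀ x, f x = ∑ i, a i * g i x := fun x => by simp [← ha]
    have hGa : G *ᵥ a = b := funext fun i => by
      rw [weightedGram_mulVec w g G hG, hb]
      simp only [hfa]
    have hca : c = a := by rw [hc, ← hGa, mulVec_mulVec, nonsing_inv_mul G hdet, one_mulVec]
    rw [hca, hfa, sub_self]


/-- For a C¹ family `θ ↦ p_θ` of strictly positive probability
distributions on a finite set `X` whose partial derivatives `∂p_θ/∂θ_i` are
linearly independent at `θ` (so `G^{(α)}(θ)` is invertible), and any `A : X → ℝ`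
with `E(θ) = ∑ x, A(x) p_θ(x)`:
`V_α[A] ≥ (1/∑ y, p_θ(y)^{1-α}) ∑_{i,j} (G^{(α)}(θ)⁻¹)_{ij} ∂_i E ∂_j E`,
with equality iff `x ↦ A(x) - E_α[A]` lies in the span of the functions
`x ↦ p_θ(x)^{α-1} ∂p_θ(x)/∂θ_i`, `i = 1,…,k`. -/
theorem variance_ge_norm_of_differential_restricted
    {X : Type*} [Fintype X] [Nonempty X] {k : ℕ}
    (Θ : Set (Fin k → ℝ)) (hΘ : IsOpen Θ)
    (p : (Fin k → ℝ) → X → ℝ)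
    (hpos : ∀ θ ∈ Θ, ∀ x, 0 < p θ x)
    (hsum : ∀ θ ∈ Θ, ∑ x, p θ x = 1)
    (hdiff : ∀ x, ContDiffOn ℝ 1 (fun θ => p θ x) Θ)
    (α : ℝ) (hα : 0 < α)
    (θ : Fin k → ℝ) (hθ : θ ∈ Θ)
    (hli : LinearIndependent ℝ
      (fun i : Fin k => fun x : X => fderiv ℝ (fun t => p t x) θ (Pi.single i 1)))
    (G : Matrix (Fin k) (Fin k) ℝ)
    (hG : ∀ i j, G i j = ∑ x, p θ x ^ (α - 1)
        * fderiv ℝ (fun t => p t x) θ (Pi.single i 1)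
        * fderiv ℝ (fun t => p t x) θ (Pi.single j 1))
    (A : X → ℝ)
    (E : (Fin k → ℝ) → ℝ) (hE : ∀ t, E t = ∑ x, A x * p t x)
    (S : ℝ) (hS : S = ∑ y, p θ y ^ (1 - α))
    (Eα : ℝ) (hEα : Eα = ∑ x, (p θ x ^ (1 - α) / S) * A x)
    (Vα : ℝ) (hVα : Vα = ∑ x, (p θ x ^ (1 - α) / S) * (A x - Eα) ^ 2) :
    Vα ≥ (1 / S) * ∑ i, ∑ j, G⁻¹ i j
        * fderiv ℝ E θ (Pi.single i 1) * fderiv ℝ E θ (Pi.single j 1)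
    ∧ (Vα = (1 / S) * ∑ i, ∑ j, G⁻¹ i j
          * fderiv ℝ E θ (Pi.single i 1) * fderiv ℝ E θ (Pi.single j 1)
        ↔ (fun x => A x - Eα) ∈ Submodule.span ℝ
            (Set.range fun i : Fin k => fun x : X =>
              p θ x ^ (α - 1) * fderiv ℝ (fun t => p t x) θ (Pi.single i 1))) := by
  have hd : ∀ x, DifferentiableAt ℝ (fun t => p t x) θ := fun x =>
    ((hdiff x).contDiffAt (hΘ.mem_nhds hθ)).differentiableAt one_ne_zero
  have hE' : ∀ v, fderiv ℝ E θ v = ∑ x, A x * fderiv ℝ (fun t => p t x) θ v := fun v => by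
    rw [funext hE, fderiv_fun_sum fun x _ => (hd x).const_mul (A x)]
    simp [fderiv_const_mul (hd _)]
  have hsum' : ∀ v, ∑ x, fderiv ℝ (fun t => p t x) θ v = 0 := fun v => by
    have h : fderiv ℝ (fun t => ∑ x, p t x) θ = 0 := by
      have heq : (fun t => ∑ x, p t x) =ᶠ[nhds θ] fun _ => (1 : ℝ) :=
        Filter.eventually_of_mem (hΘ.mem_nhds hθ) hsum
      rw [heq.fderiv_eq, fderiv_fun_const, Pi.zero_apply]
    rw [fderiv_fun_sum fun x _ => hd x] at h
    simpa using congrArg (fun L => L v) h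
  have hw : ∀ x, 0 < p θ x ^ (1 - α) := fun x => Real.rpow_pos_of_pos (hpos θ hθ x) _
  have hinv : ∀ x, p θ x ^ (1 - α) * p θ x ^ (α - 1) = 1 := fun x => by
    rw [← Real.rpow_add (hpos θ hθ x)]
    simp
  have hSpos : 0 < S := hS ▸ sum_pos (fun x _ => hw x) univ_nonempty
  have hg : LinearIndependent ℝ (fun i : Fin k => fun x : X =>
      p θ x ^ (α - 1) * fderiv ℝ (fun t => p t x) θ (Pi.single i 1)) := by
    rw [Fintype.linearIndependent_iff] at hli ⊢
    refine fun c hc => hli c (funext fun x => ?_)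
    have h := congrFun hc x
    simp only [Finset.sum_apply, Pi.smul_apply, smul_eq_mul, Pi.zero_apply] at h ⊢
    rw [← mul_zero (p θ x ^ (1 - α)), ← h, mul_sum]
    refine sum_congr rfl fun i _ => ?_
    linear_combination
      (-(c i * fderiv ℝ (fun t => p t x) θ (Pi.single i 1))) * hinv x
  obtain ⟨hle, heq⟩ := weighted_bessel hw hg G
    (fun i j => (hG i j).trans <| sum_congr rfl fun x _ => by
      linear_combination (-(p θ x ^ (α - 1) * fderiv ℝ (fun t => p t x) θ (Pi.single i 1)
        * fderiv ℝ (fun t => p t x) θ (Pi.single j 1))) * hinv x)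
    (fun x => A x - Eα) (fun i => fderiv ℝ E θ (Pi.single i 1)) (fun i => by
      have h : ∑ x, Eα * fderiv ℝ (fun t => p t x) θ (Pi.single i 1) = 0 := by
        rw [← mul_sum, hsum', mul_zero]
      rw [hE', ← sub_zero (∑ x, A x * _), ← h, ← sum_sub_distrib]
      refine sum_congr rfl fun x _ => ?_
      linear_combination
        (-((A x - Eα) * fderiv ℝ (fun t => p t x) θ (Pi.single i 1))) * hinv x)
  have hV : Vα = (1 / S) * ∑ x, p θ x ^ (1 - α) * (A x - Eα) ^ 2 := by
    rw [hVα, mul_sum]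
    exact sum_congr rfl fun x _ => by ring
  rw [hV, mul_right_inj' (one_div_pos.2 hSpos).ne']
  exact ⟨mul_le_mul_of_nonneg_left hle (one_div_pos.2 hSpos).le, heq⟩
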